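/- Suppose the cost-difference vectors {Δc_t(·,1)}_{t=1}^T, where Δc_t(·,1) = (c_t(2)-c_t(1), ..., c_t(M)-c_t(1)), contain at least three linearly independent elements. Then the pooled day-to-day model with parameters η, θ, ρ, and the initial relative valuations δ(2), ..., δ(M), where δ(j) = V_1(j) − V_1(1), is identifiable: equality of all choice-sequence probabilities under two parameter sets implies the parameter sets are equal. -/

import Mathlib

/-!
STATEMENT 9: If the cost-difference vectors {Δc_t(·,1)}_{t=1}^T (components
c_t(j) − c_t(1)) contain at least three linearly independent elements, then the pooled
model with parameters η, θ, ρ and the initial relative valuations δ(j) = V₁(j) − V₁(1)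
is identifiable: equality of all choice-sequence probabilities under two parameter sets
implies the parameter sets are equal.
(The initial valuations are parameterized by the vector δ : Fin M → ℝ with δ(1) = 0,
i.e. V₁ = δ, which encodes exactly the relative differences δ(2), ..., δ(M).)
-/

noncomputable section

/-- Perceived costs with initial values `V1`. -/
def percVal (M : ℕ) (V1 : Fin M → ℝ) (c : ℕ → Fin M → ℝ) (η : ℝ) : ℕ → Fin M → ℝ
  | 0 => V1
  | t + 1 => fun i => (1 - η) * percVal M V1 c η t i + η * c t i

/-- Day-`t` choice probabilities: option 0 (non-travel) with probability ρ,
path `i` with probability (1-ρ)·exp(-θ V_t(i)) / Σ_m exp(-θ V_t(m)). -/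
def choiceProb (M : ℕ) (V1 : Fin M → ℝ) (c : ℕ → Fin M → ℝ) (η θ ρ : ℝ) (t : ℕ) :
    Fin (M + 1) → ℝ :=
  fun k => Fin.cases ρ
    (fun i => (1 - ρ) * Real.exp (-θ * percVal M V1 c η t i) /
      ∑ m : Fin M, Real.exp (-θ * percVal M V1 c η t m)) k

/-- Probability of a full joint choice sequence of all `N` commuters. -/
def seqProb (M N T : ℕ) (V1 : Fin M → ℝ) (c : ℕ → Fin M → ℝ) (η θ ρ : ℝ)
    (x : Fin T → Fin N → Fin (M + 1)) : ℝ :=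
  ∏ t : Fin T, ∏ n : Fin N, choiceProb M V1 c η θ ρ t (x t n)

/-- A product of probability vectors determines each of its factors. -/
lemma eq_of_prod_apply_eq {ι κ : Type*} [Fintype ι] [Fintype κ]
    (f g : ι → κ → ℝ) (hf : ∀ i k, 0 < f i k)
    (hf1 : ∀ i, ∑ k, f i k = 1) (hg1 : ∀ i, ∑ k, g i k = 1)
    (h : ∀ x : ι → κ, ∏ i, f i (x i) = ∏ i, g i (x i)) : f = g := by
  classical
  funext i k
  have split (p : ι → κ → ℝ) (l : κ) :
      ∏ j, p j (Function.update (fun _ => k) i l j) =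
        p i l * ∏ j ∈ Finset.univ.erase i, p j k := by
    rw [← Finset.mul_prod_erase Finset.univ _ (Finset.mem_univ i), Function.update_self]
    congr 1
    refine Finset.prod_congr rfl fun j hj => ?_
    rw [Function.update_of_ne (Finset.ne_of_mem_erase hj)]
  have hl (l : κ) : f i l * ∏ j ∈ Finset.univ.erase i, f j k =
      g i l * ∏ j ∈ Finset.univ.erase i, g j k := by
    rw [← split f, ← split g, h]
  have hR : ∏ j ∈ Finset.univ.erase i, f j k = ∏ j ∈ Finset.univ.erase i, g j k := by
    have := Finset.sum_congr (rfl : (Finset.univ : Finset κ) = _) fun l _ => hl l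
    rwa [← Finset.sum_mul, ← Finset.sum_mul, hf1, hg1, one_mul, one_mul] at this
  have hpos : 0 < ∏ j ∈ Finset.univ.erase i, f j k := Finset.prod_pos fun j _ => hf j k
  have hk := hl k
  rw [← hR] at hk
  exact mul_right_cancel₀ hpos.ne' hk

/-- If three of the vectors `d 0, …, d (T - 1)` are linearly independent, then
`d 0, …, d (T - 2)` do not all lie on one line. -/
lemma exists_notMem_span_singleton {E : Type*} [AddCommGroup E] [Module ℝ E]
    {T : ℕ} {d : ℕ → E} {t1 t2 t3 : ℕ} (h1 : t1 < T) (h2 : t2 < T) (h3 : t3 < T)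
    (hli : LinearIndependent ℝ ![d t1, d t2, d t3]) (u : E) :
    ∃ t, t + 1 < T ∧ d t ∉ Submodule.span ℝ {u} := by
  classical
  by_contra! hcon
  have hmem (t : ℕ) (ht : t < T) :
      d t ∈ Submodule.span ℝ (({u, d (T - 1)} : Finset E) : Set E) := by
    by_cases hlt : t + 1 < T
    · exact Submodule.span_mono (by simp) (hcon t hlt)
    · obtain rfl : t = T - 1 := by omega
      exact Submodule.subset_span (by simp)
  have hle : Submodule.span ℝ (Set.range ![d t1, d t2, d t3]) ≤
      Submodule.span ℝ (({u, d (T - 1)} : Finset E) : Set E) := by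
    rw [Submodule.span_le]
    rintro _ ⟨i, rfl⟩
    fin_cases i
    exacts [hmem t1 h1, hmem t2 h2, hmem t3 h3]
  have hrank := Submodule.finrank_mono hle
  rw [finrank_span_eq_card hli, Fintype.card_fin] at hrank
  have := hrank.trans ((finrank_span_finset_le_card _).trans Finset.card_le_two)
  omega

/-- A trajectory of exponential smoothing determines the rate and the gain, unless the
effective inputs lie on one line. -/
lemma smoothing_rate_gain_eq {E : Type*} [AddCommGroup E] [Module ℝ E]
    {T : ℕ} {d w : ℕ → E} {η θ η' θ' : ℝ} (hη : 0 < η) (hθ : 0 < θ)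
    (hd : ∀ u : E, ∃ t, t + 1 < T ∧ d t ∉ Submodule.span ℝ {u})
    (hw : ∀ t, t + 1 < T → w (t + 1) = (1 - η) • w t + (η * θ) • d t)
    (hw' : ∀ t, t + 1 < T → w (t + 1) = (1 - η') • w t + (η' * θ') • d t) :
    η = η' ∧ θ = θ' := by
  have hdiff (t : ℕ) (ht : t + 1 < T) :
      (η' - η) • w t = (η' * θ' - η * θ) • d t := by
    have h := (hw t ht).symm.trans (hw' t ht)
    rw [← sub_eq_zero] at h ⊢
    rw [← h]
    module
  have hη_eq : η = η' := by
    by_contra hne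
    have hne' : η' - η ≠ 0 := sub_ne_zero.mpr (Ne.symm hne)
    obtain ⟨κ, hκ⟩ : ∃ κ : ℝ, ∀ t, t + 1 < T → w t = κ • d t := by
      refine ⟨(η' - η)⁻¹ * (η' * θ' - η * θ), fun t ht => ?_⟩
      rw [mul_smul, ← hdiff t ht, inv_smul_smul₀ hne']
    have hstep (t : ℕ) (ht : t + 2 < T) :
        κ • d (t + 1) = ((1 - η) * κ + η * θ) • d t := by
      rw [← hκ (t + 1) ht, hw t (by omega), hκ t (by omega)]
      module
    by_cases hκ0 : κ = 0
    · obtain ⟨t, ht, hnot⟩ := hd (d (T - 2))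
      by_cases hlast : t = T - 2
      · exact hnot (hlast ▸ Submodule.mem_span_singleton_self _)
      · have h := hstep t (by omega)
        rw [hκ0, zero_smul, mul_zero, zero_add, eq_comm,
          smul_eq_zero_iff_right (mul_pos hη hθ).ne'] at h
        exact hnot (by rw [h]; exact Submodule.zero_mem _)
    · obtain ⟨t, ht, hnot⟩ := hd (d 0)
      refine hnot ?_
      clear hnot
      induction t with
      | zero => exact Submodule.mem_span_singleton_self _
      | succ t ih =>
        have h := Submodule.smul_mem _ ((1 - η) * κ + η * θ) (ih (by omega))
        rw [← hstep t ht] at h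
        exact (Submodule.smul_mem_iff _ hκ0).mp h
  subst hη_eq
  refine ⟨rfl, ?_⟩
  obtain ⟨t, ht, hnot⟩ := hd 0
  have h := hdiff t ht
  rw [sub_self, zero_smul, eq_comm, smul_eq_zero] at h
  rcases h with h | h
  · exact (mul_left_cancel₀ hη.ne' (sub_eq_zero.mp h)).symm
  · exact absurd (by rw [h]; exact Submodule.zero_mem _) hnot

lemma sum_exp_percVal_pos {M : ℕ} (hM : 0 < M) (V : Fin M → ℝ) (c : ℕ → Fin M → ℝ)
    (η θ : ℝ) (t : ℕ) : 0 < ∑ m : Fin M, Real.exp (-θ * percVal M V c η t m) :=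
  Finset.sum_pos (fun _ _ => Real.exp_pos _) ⟨⟨0, hM⟩, Finset.mem_univ _⟩

lemma choiceProb_pos {M : ℕ} (hM : 0 < M) (V : Fin M → ℝ) (c : ℕ → Fin M → ℝ) (η θ : ℝ)
    {ρ : ℝ} (hρ : ρ ∈ Set.Ioo (0 : ℝ) 1) (t : ℕ) (k : Fin (M + 1)) :
    0 < choiceProb M V c η θ ρ t k := by
  refine Fin.cases hρ.1 (fun i => ?_) k
  exact div_pos (mul_pos (sub_pos.mpr hρ.2) (Real.exp_pos _)) (sum_exp_percVal_pos hM V c η θ t)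

lemma sum_choiceProb {M : ℕ} (hM : 0 < M) (V : Fin M → ℝ) (c : ℕ → Fin M → ℝ)
    (η θ ρ : ℝ) (t : ℕ) : ∑ k, choiceProb M V c η θ ρ t k = 1 := by
  have hS := (sum_exp_percVal_pos hM V c η θ t).ne'
  rw [Fin.sum_univ_succ]
  simp only [choiceProb, Fin.cases_zero, Fin.cases_succ]
  rw [← Finset.sum_div, ← Finset.mul_sum, mul_div_cancel_right₀ _ hS]
  ring

/-- Log-odds of path `i` against path `j`. -/
lemma log_choiceProb_sub {M : ℕ} (hM : 0 < M) (V : Fin M → ℝ) (c : ℕ → Fin M → ℝ)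
    (η θ : ℝ) {ρ : ℝ} (hρ : ρ ∈ Set.Ioo (0 : ℝ) 1) (t : ℕ) (i j : Fin M) :
    Real.log (choiceProb M V c η θ ρ t j.succ) - Real.log (choiceProb M V c η θ ρ t i.succ) =
      θ * (percVal M V c η t i - percVal M V c η t j) := by
  have hS := (sum_exp_percVal_pos hM V c η θ t).ne'
  have hρ' : 1 - ρ ≠ 0 := (sub_pos.mpr hρ.2).ne'
  simp only [choiceProb, Fin.cases_succ]
  rw [Real.log_div (mul_ne_zero hρ' (Real.exp_ne_zero _)) hS,
    Real.log_div (mul_ne_zero hρ' (Real.exp_ne_zero _)) hS,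
    Real.log_mul hρ' (Real.exp_ne_zero _), Real.log_mul hρ' (Real.exp_ne_zero _),
    Real.log_exp, Real.log_exp]
  ring

theorem endogenized_initial_values_identifiable
    (M N T : ℕ) (hM : 0 < M) (hN : 0 < N) (hT : 0 < T)
    (c : ℕ → Fin M → ℝ) (C : ℝ) (hc : ∀ t i, |c t i| ≤ C)
    -- stronger dynamic richness: three linearly independent cost-difference vectors
    (hrich : ∃ t1 t2 t3 : ℕ, t1 < T ∧ t2 < T ∧ t3 < T ∧
      LinearIndependent ℝ
        ![(fun j : Fin M => c t1 j - c t1 ⟨0, hM⟩),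
          (fun j : Fin M => c t2 j - c t2 ⟨0, hM⟩),
          (fun j : Fin M => c t3 j - c t3 ⟨0, hM⟩)]) :
    ∀ (η θ ρ η' θ' ρ' : ℝ) (δ δ' : Fin M → ℝ),
      η ∈ Set.Ioo (0 : ℝ) 1 → 0 < θ → ρ ∈ Set.Ioo (0 : ℝ) 1 →
      η' ∈ Set.Ioo (0 : ℝ) 1 → 0 < θ' → ρ' ∈ Set.Ioo (0 : ℝ) 1 →
      δ ⟨0, hM⟩ = 0 → δ' ⟨0, hM⟩ = 0 →
      (∀ x : Fin T → Fin N → Fin (M + 1),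
        seqProb M N T δ c η θ ρ x = seqProb M N T δ' c η' θ' ρ' x) →
      η = η' ∧ θ = θ' ∧ ρ = ρ' ∧ δ = δ' := by
  obtain ⟨t1, t2, t3, h1, h2, h3, hli⟩ := hrich
  intro η θ ρ η' θ' ρ' δ δ' hη hθ hρ hη' hθ' hρ' hδ hδ' hseq
  set o : Fin M := ⟨0, hM⟩
  have hprob (t : ℕ) (ht : t < T) :
      choiceProb M δ c η θ ρ t = choiceProb M δ' c η' θ' ρ' t := by
    have h := eq_of_prod_apply_eq
      (fun i : Fin T × Fin N => choiceProb M δ c η θ ρ i.1)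
      (fun i : Fin T × Fin N => choiceProb M δ' c η' θ' ρ' i.1)
      (fun i => choiceProb_pos hM δ c η θ hρ i.1)
      (fun i => sum_choiceProb hM δ c η θ ρ i.1)
      (fun i => sum_choiceProb hM δ' c η' θ' ρ' i.1)
      (fun x => by
        simpa only [Fintype.prod_prod_type, seqProb] using hseq fun t n => x (t, n))
    exact congrFun h (⟨t, ht⟩, ⟨0, hN⟩)
  have hρ_eq : ρ = ρ' := congrFun (hprob 0 hT) 0
  have hval (t : ℕ) (ht : t < T) (j : Fin M) :
      θ * (percVal M δ c η t j - percVal M δ c η t o) =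
        θ' * (percVal M δ' c η' t j - percVal M δ' c η' t o) := by
    rw [← log_choiceProb_sub hM δ c η θ hρ, ← log_choiceProb_sub hM δ' c η' θ' hρ', hprob t ht]
  obtain ⟨hη_eq, hθ_eq⟩ := smoothing_rate_gain_eq (T := T)
    (d := fun t j => c t j - c t o)
    (w := fun t j => θ * (percVal M δ c η t j - percVal M δ c η t o))
    (η' := η') (θ' := θ') hη.1 hθ
    (exists_notMem_span_singleton (d := fun t j => c t j - c t o) h1 h2 h3 hli)
    (fun t _ => by
      funext j
      simp only [percVal, Pi.add_apply, Pi.smul_apply, smul_eq_mul]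
      ring)
    (fun t ht => by
      funext j
      simp only [Pi.add_apply, Pi.smul_apply, smul_eq_mul]
      rw [hval (t + 1) ht, hval t (by omega)]
      simp only [percVal]
      ring)
  refine ⟨hη_eq, hθ_eq, hρ_eq, funext fun j => ?_⟩
  have h := hval 0 hT j
  simp only [percVal, hδ, hδ', sub_zero, ← hθ_eq] at h
  exact mul_left_cancel₀ hθ.ne' h
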